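/- No universal probability is computable: if m is a universal probability, then there is no total recursive function f : ℕ⁺ × {0,1}* → ℚ with |m(s) - f(n,s)| < 2^{-n} for all n and s. -/

import Mathlib

open Filter Topology

namespace Paper

/-- Finite binary strings. -/
abbrev Str := List Bool

/-- A computer: a partial recursive function on binary strings with prefix-free domain. -/
structure Computer where
  f : Str →. Str
  partrec : Partrec f
  prefixFree : ∀ p q : Str, (f p).Dom → (f q).Dom → p <+: q → p = q

/-- An optimal computer (universal self-delimiting Turing machine). -/
structure OptimalComputer extends Computer where
  optimal : ∀ C : Computer, ∃ sim : ℕ, ∀ p s, s ∈ C.f p →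
    ∃ p', s ∈ toComputer.f p' ∧ p'.length ≤ p.length + sim

/-- Prefix-free Kolmogorov complexity (program-size complexity) w.r.t. `U`. -/
noncomputable def Kc (U : OptimalComputer) (s : Str) : ℕ :=
  sInf {n | ∃ p : Str, p.length = n ∧ s ∈ U.f p}

/-- A semi-measure on binary strings: values in [0,1] with all finite partial sums ≤ 1. -/
def SemiMeasure (r : Str → ℝ) : Prop :=
  (∀ s, 0 ≤ r s ∧ r s ≤ 1) ∧ ∀ F : Finset Str, ∑ s ∈ F, r s ≤ 1

/-- Lower-computability: approximability from below by a total recursive rational function. -/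
def LowerComputable (r : Str → ℝ) : Prop :=
  ∃ f : ℕ → Str → ℚ, Computable₂ f ∧
    ∀ s : Str, (∀ n : ℕ, 0 ≤ f n s ∧ (f n s : ℝ) ≤ r s) ∧
      Tendsto (fun n => (f n s : ℝ)) atTop (nhds (r s))

/-- A lower-computable semi-measure. -/
def LCSemiMeasure (r : Str → ℝ) : Prop := SemiMeasure r ∧ LowerComputable r

/-- A universal probability: a lower-computable semi-measure dominating all
lower-computable semi-measures up to a positive multiplicative constant. -/
def UniversalProb (m : Str → ℝ) : Prop :=
  LCSemiMeasure m ∧ ∀ r : Str → ℝ, LCSemiMeasure r → ∃ c : ℝ, 0 < c ∧ ∀ s, c * r s ≤ m s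

/-- The first `n` bits of the base-two expansion of `T mod 1`
(the expansion with infinitely many zeros). -/
noncomputable def binPrefix (T : ℝ) (n : ℕ) : Str :=
  (List.range n).map (fun i => decide (⌊Int.fract T * 2 ^ (i + 1)⌋ % 2 = 1))

/-- A real is right-computable if it is the limit from above of a recursive
sequence of rationals. -/
def RightComputableReal (T : ℝ) : Prop :=
  ∃ g : ℕ → ℚ, Computable g ∧ (∀ n, T ≤ (g n : ℝ)) ∧
    Tendsto (fun n => (g n : ℝ)) atTop (nhds T)

/-- A real is left-computable if its negation is right-computable. -/
def LeftComputableReal (T : ℝ) : Prop := RightComputableReal (-T)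

/-- A computable real number. -/
def ComputableReal (T : ℝ) : Prop :=
  ∃ f : ℕ → ℚ, Computable f ∧ ∀ n : ℕ, |T - (f n : ℝ)| < (2 : ℝ)⁻¹ ^ n

/-- A recursively enumerable set of binary strings. -/
def REset (A : Set Str) : Prop :=
  ∃ g : Str →. Unit, Partrec g ∧ ∀ s, (g s).Dom ↔ s ∈ A

/-- `T` is weakly Chaitin `D`-random. -/
noncomputable def WeaklyChaitinDRandom (U : OptimalComputer) (D T : ℝ) : Prop :=
  ∃ c : ℕ, ∀ n : ℕ, D * n - c ≤ Kc U (binPrefix T n)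

/-- `T` is `D`-compressible. -/
noncomputable def DCompressible (U : OptimalComputer) (D T : ℝ) : Prop :=
  Filter.atTop.limsup (fun n : ℕ => (Kc U (binPrefix T n) : ℝ) / n) ≤ D


open Encodable

/-- The raw numeric code of a rational. -/
noncomputable def ratCode (q : ℚ) : ℕ := @encode ℚ Rat.instEncodable q

/-- The range of `ratCode`, arithmetically. -/
def IsCode (y : ℕ) : Prop :=
  0 < y.unpair.2 ∧ ((y.unpair.1 + 1) / 2).Coprime y.unpair.2

instance : DecidablePred IsCode := fun y => by unfold IsCode; infer_instance

theorem ratCode_eq (q : ℚ) : ratCode q = Nat.pair (Equiv.intEquivNat q.num) q.den := rfl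

theorem natAbs_of_code (a : ℤ) : (Equiv.intEquivNat a + 1) / 2 = a.natAbs := by
  cases a with
  | ofNat n =>
    have : Equiv.intEquivNat (Int.ofNat n) = 2 * n := rfl
    rw [this]; simp; omega
  | negSucc n =>
    have : Equiv.intEquivNat (Int.negSucc n) = 2 * n + 1 := rfl
    rw [this]; simp; omega

theorem isCode_iff (y : ℕ) : IsCode y ↔ ∃ q, ratCode q = y := by
  constructor
  · rintro ⟨h1, h2⟩
    have h3 := natAbs_of_code (Equiv.intEquivNat.symm y.unpair.1)
    rw [Equiv.apply_symm_apply] at h3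
    refine ⟨⟨Equiv.intEquivNat.symm y.unpair.1, y.unpair.2, h1.ne', h3 ▸ h2⟩, ?_⟩
    rw [ratCode_eq]
    simp
  · rintro ⟨q, rfl⟩
    rw [ratCode_eq, IsCode]
    simp only [Nat.unpair_pair, natAbs_of_code]
    exact ⟨q.pos, q.reduced⟩

/-- The code of a rational used by `Computable`. -/
def encRat (q : ℚ) : ℕ := @encode ℚ Primcodable.toEncodable q

theorem encRat_injective : Function.Injective encRat :=
  @encode_injective ℚ Primcodable.toEncodable

theorem encode_rat (q : ℚ) : encRat q = Nat.count IsCode (ratCode q) := by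
  have : @encode ℚ (Primcodable.toEncodable) q = (List.range (ratCode q)).countP
      (fun y => @decide (y ∈ Set.range (@encode ℚ Rat.instEncodable))
        (decidableRangeEncode ℚ y)) := rfl
  refine Eq.trans this ?_
  rw [Nat.count_eq_card_filter_range, List.countP_eq_length_filter]
  show _ = (List.filter _ _).length
  congr 2
  funext y
  rw [decide_eq_decide]
  exact (isCode_iff y).symm

theorem primrec_isCode : PrimrecPred IsCode := by
  have hy1 : Primrec (fun y : ℕ => (y.unpair.1 + 1) / 2) :=
    Primrec.nat_div.comp (Primrec.succ.comp (Primrec.fst.comp Primrec.unpair)) (Primrec.const 2)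
  have hy2 : Primrec (fun y : ℕ => y.unpair.2) := Primrec.snd.comp Primrec.unpair
  have hR : PrimrecRel (fun x y : ℕ =>
      ¬ (((y.unpair.1 + 1) / 2) % x = 0 ∧ y.unpair.2 % x = 0 ∧ x ≠ 1)) := by
    refine PrimrecPred.not (PrimrecPred.and ?_ (PrimrecPred.and ?_ (PrimrecPred.not ?_)))
    · exact Primrec.eq.comp (Primrec.nat_mod.comp (hy1.comp Primrec.snd) Primrec.fst)
        (Primrec.const 0)
    · exact Primrec.eq.comp (Primrec.nat_mod.comp (hy2.comp Primrec.snd) Primrec.fst)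
        (Primrec.const 0)
    · exact Primrec.eq.comp Primrec.fst (Primrec.const 1)
  have h := hR.forall_lt
  have h2 : PrimrecPred (fun y : ℕ => 0 < y.unpair.2 ∧ ∀ x < y.unpair.2 + 1,
      ¬ (((y.unpair.1 + 1) / 2) % x = 0 ∧ y.unpair.2 % x = 0 ∧ x ≠ 1)) := by
    refine PrimrecPred.and (Primrec.nat_lt.comp (Primrec.const 0) hy2) ?_
    exact h.comp (Primrec.succ.comp hy2) Primrec.id
  refine h2.of_eq fun y => ?_
  unfold IsCode
  refine and_congr_right fun hpos => ?_
  constructor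
  · intro h
    by_contra hc
    refine h (Nat.gcd ((y.unpair.1 + 1) / 2) y.unpair.2) ?_ ⟨?_, ?_, hc⟩
    · exact Nat.lt_succ_of_le (Nat.gcd_le_right _ hpos)
    · exact Nat.mod_eq_zero_of_dvd (Nat.gcd_dvd_left _ _)
    · exact Nat.mod_eq_zero_of_dvd (Nat.gcd_dvd_right _ _)
  · rintro h x - ⟨h1, h2, h3⟩
    exact h3 (Nat.eq_one_of_dvd_coprimes h (Nat.dvd_of_mod_eq_zero h1)
      (Nat.dvd_of_mod_eq_zero h2))

theorem primrec_count : Primrec (Nat.count IsCode) := by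
  have : Primrec₂ (fun (_ : ℕ) (n : ℕ) => Nat.rec (motive := fun _ => ℕ) 0
      (fun k ih => if IsCode k then ih + 1 else ih) n) := by
    refine Primrec.nat_rec (Primrec.const 0)
      (g := fun _ (p : ℕ × ℕ) => if IsCode p.1 then p.2 + 1 else p.2) ?_
    exact Primrec.ite (primrec_isCode.comp (Primrec.fst.comp Primrec.snd))
      (Primrec.succ.comp (Primrec.snd.comp Primrec.snd)) (Primrec.snd.comp Primrec.snd)
  refine (this.comp (Primrec.const 0) Primrec.id).of_eq fun n => ?_
  induction n with
  | zero => simp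
  | succ n ih =>
    rw [Nat.count_succ, ← ih]
    simp only [id]
    split_ifs <;> rfl

theorem primrec_pow_two : Primrec (fun n : ℕ => 2 ^ n) := by
  have : Primrec₂ (fun (_ : ℕ) (n : ℕ) => Nat.rec (motive := fun _ => ℕ) 1
      (fun _ ih => ih * 2) n) := by
    refine Primrec.nat_rec (Primrec.const 1) (g := fun _ (p : ℕ × ℕ) => p.2 * 2) ?_
    exact Primrec.nat_mul.comp (Primrec.snd.comp Primrec.snd) (Primrec.const 2)
  refine (this.comp (Primrec.const 0) Primrec.id).of_eq fun n => ?_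
  induction n with
  | zero => simp
  | succ n ih => rw [pow_succ, ← ih]; rfl

theorem computable_half_pow : Computable (fun n : ℕ => ((2 : ℚ)⁻¹) ^ n) := by
  have hc : ∀ n : ℕ, ratCode ((2 : ℚ)⁻¹ ^ n) = Nat.pair 2 (2 ^ n) := by
    intro n
    rw [ratCode_eq]
    have h1 : ((2 : ℚ)⁻¹ ^ n).num = 1 := by
      rw [Rat.num_pow]; norm_num
    have h2 : ((2 : ℚ)⁻¹ ^ n).den = 2 ^ n := by
      rw [Rat.den_pow]; norm_num
    rw [h1, h2]; rfl
  have : Primrec (fun n : ℕ => Nat.count IsCode (Nat.pair 2 (2 ^ n))) :=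
    primrec_count.comp (Primrec₂.natPair.comp (Primrec.const 2) primrec_pow_two)
  refine Primrec.to_comp (Primrec.encode_iff.1 (this.of_eq fun n => ?_))
  rw [← hc, ← encode_rat]; rfl

theorem computable_ratCode : Computable ratCode := by
  classical
  have hex : ∀ q : ℚ, ∃ y, IsCode y ∧ Nat.count IsCode y = encRat q := fun q =>
    ⟨ratCode q, (isCode_iff _).2 ⟨q, rfl⟩, (encode_rat q).symm⟩
  have hP : PrimrecPred (fun p : ℚ × ℕ => IsCode p.2 ∧ Nat.count IsCode p.2 = encRat p.1) :=
    (primrec_isCode.comp Primrec.snd).and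
      (Primrec.eq.comp (primrec_count.comp Primrec.snd) (Primrec.encode.comp Primrec.fst))
  have := Computable.find (P := fun (q : ℚ) y => IsCode y ∧ Nat.count IsCode y = encRat q)
    (by
      obtain ⟨d, hd⟩ := hP
      exact ⟨d, hd.to_comp⟩) hex
  refine this.of_eq fun q => ?_
  obtain ⟨h1, h2⟩ := Nat.find_spec (hex q)
  obtain ⟨q', hq'⟩ := (isCode_iff _).1 h1
  rw [← hq', ← encode_rat] at h2
  exact hq'.symm.trans (congrArg ratCode (encRat_injective h2))

theorem computablePred_comp {α β : Type} [Primcodable α] [Primcodable β] {p : β → Prop}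
    (hp : ComputablePred p) {g : α → β} (hg : Computable g) :
    ComputablePred (fun a => p (g a)) := by
  obtain ⟨d, hd⟩ := hp
  exact ⟨fun a => d (g a), hd.comp hg⟩

/-- Comparison of the absolute value of a rational with a power of one half. -/
theorem computable_small : ComputablePred
    (fun p : ℚ × ℕ => |p.1| < (2 : ℚ)⁻¹ ^ p.2) := by
  have h : PrimrecPred (fun p : ℕ × ℕ => ((p.1.unpair.1 + 1) / 2) * 2 ^ p.2 < p.1.unpair.2) := by
    refine Primrec.nat_lt.comp (Primrec.nat_mul.comp ?_ (primrec_pow_two.comp Primrec.snd)) ?_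
    · exact Primrec.nat_div.comp (Primrec.succ.comp
        (Primrec.fst.comp (Primrec.unpair.comp Primrec.fst))) (Primrec.const 2)
    · exact Primrec.snd.comp (Primrec.unpair.comp Primrec.fst)
  have h' : ComputablePred
      (fun p : ℕ × ℕ => ((p.1.unpair.1 + 1) / 2) * 2 ^ p.2 < p.1.unpair.2) := by
    obtain ⟨d, hd⟩ := h
    exact ⟨d, hd.to_comp⟩
  have h2 : ComputablePred (fun p : ℚ × ℕ =>
      (((ratCode p.1).unpair.1 + 1) / 2) * 2 ^ p.2 < (ratCode p.1).unpair.2) :=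
    computablePred_comp h' (g := fun p : ℚ × ℕ => (ratCode p.1, p.2))
      ((computable_ratCode.comp Computable.fst).pair Computable.snd)
  refine h2.of_eq fun p => ?_
  rw [ratCode_eq]
  simp only [Nat.unpair_pair, natAbs_of_code]
  have hd : (0 : ℚ) < p.1.den := by exact_mod_cast p.1.pos
  have h3 : |p.1| = (p.1.num.natAbs : ℚ) / p.1.den := by
    conv_lhs => rw [← Rat.num_div_den p.1]
    rw [abs_div, Nat.cast_natAbs, Nat.abs_cast, Int.cast_abs]
  rw [h3, inv_pow, div_lt_iff₀ hd, inv_mul_eq_div, lt_div_iff₀ (by positivity)]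
  exact_mod_cast Iff.rfl

/-- `n` copies of `true`. -/
def ones (n : ℕ) : Str := List.replicate n true

theorem primrec_ones : Primrec ones := by
  have : Primrec₂ (fun (_ : ℕ) (n : ℕ) => Nat.rec (motive := fun _ => Str) []
      (fun _ ih => true :: ih) n) := by
    refine Primrec.nat_rec (Primrec.const []) (g := fun _ (p : ℕ × Str) => true :: p.2) ?_
    exact Primrec.list_cons.comp (Primrec.const true) (Primrec.snd.comp Primrec.snd)
  refine (this.comp (Primrec.const 0) Primrec.id).of_eq fun n => ?_
  induction n with
  | zero => rfl
  | succ n ih => rw [ones, List.replicate_succ, ← ones, ← ih]; rfl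

theorem ones_injective : Function.Injective ones := fun a b h => by
  simpa [ones] using congrArg List.length h

theorem exists_small (m : Str → ℝ) (hm : SemiMeasure m) (k : ℕ) (ε : ℝ) (hε : 0 < ε) :
    ∃ j : ℕ, m (ones (Nat.pair k j)) < ε := by
  by_contra! h
  obtain ⟨N, hN⟩ := exists_nat_gt (1 / ε)
  have hinj : Function.Injective (fun j => ones (Nat.pair k j)) := fun a b hab => by
    have := ones_injective hab
    exact (Nat.pair_eq_pair.1 this).2
  have h1 := hm.2 ((Finset.range N).map ⟨_, hinj⟩)
  rw [Finset.sum_map] at h1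
  have h2 : ∑ _j ∈ Finset.range N, ε ≤ 1 := (Finset.sum_le_sum fun j _ => h j).trans h1
  rw [Finset.sum_const, Finset.card_range, nsmul_eq_mul] at h2
  rw [div_lt_iff₀ hε] at hN
  linarith

/-- A sparse weight. -/
def sparse (J : ℕ → ℕ) (s : Str) : ℚ :=
  if s = ones (Nat.pair s.length.unpair.1 (J s.length.unpair.1))
    then (2 : ℚ)⁻¹ ^ (s.length.unpair.1 + 1) else 0

theorem computable_sparse (J : ℕ → ℕ) (hJ : Computable J) : Computable (sparse J) := by
  have hk : Computable (fun s : Str => s.length.unpair.1) :=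
    (Primrec.fst.comp (Primrec.unpair.comp Primrec.list_length)).to_comp
  have hs : Computable (fun s : Str => ones (Nat.pair s.length.unpair.1 (J s.length.unpair.1))) :=
    primrec_ones.to_comp.comp (Primrec₂.natPair.to_comp.comp hk (hJ.comp hk))
  have heq : Computable₂ (fun a b : Str => decide (a = b)) := (Primrec.eq (α := Str)).decide.to_comp
  have hc := Computable.cond (heq.comp Computable.id hs)
    (computable_half_pow.comp (Computable.succ.comp hk)) (Computable.const (0 : ℚ))
  refine hc.of_eq fun s => ?_
  simp only [id, sparse, Nat.succ_eq_add_one, Bool.cond_decide]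

theorem sparse_nonneg (J : ℕ → ℕ) (s : Str) : 0 ≤ sparse J s := by
  unfold sparse; split_ifs <;> positivity

theorem sparse_ones (J : ℕ → ℕ) (k : ℕ) :
    sparse J (ones (Nat.pair k (J k))) = (2 : ℚ)⁻¹ ^ (k + 1) := by
  simp [sparse, ones]

theorem sparse_sum (J : ℕ → ℕ) (F : Finset Str) : ∑ s ∈ F, (sparse J s : ℝ) ≤ 1 := by
  classical
  set g : Str → ℕ := fun s => s.length.unpair.1
  have h1 : ∑ s ∈ F, (sparse J s : ℝ) =
      ∑ s ∈ F with s = ones (Nat.pair (g s) (J (g s))), (1 / 2 / 2 ^ (g s) : ℝ) := by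
    rw [Finset.sum_filter]
    refine Finset.sum_congr rfl fun s _ => ?_
    unfold sparse
    simp only [g]
    split_ifs
    · push_cast
      rw [pow_succ, inv_pow]; field_simp
    · simp
  have hinj : Set.InjOn g (F.filter fun s => s = ones (Nat.pair (g s) (J (g s)))) := by
    intro a ha b hb hab
    have ha' := (Finset.mem_filter.1 ha).2
    have hb' := (Finset.mem_filter.1 hb).2
    rw [ha', hb', hab]
  rw [h1, ← Finset.sum_image (f := fun k : ℕ => (1 / 2 / 2 ^ k : ℝ)) hinj]
  refine le_of_le_of_eq ?_ (tsum_geometric_two' 1)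
  exact (summable_geometric_two' 1).sum_le_tsum _ fun i _ => by positivity

theorem sparse_lc (J : ℕ → ℕ) (hJ : Computable J) :
    LCSemiMeasure (fun s => (sparse J s : ℝ)) := by
  refine ⟨⟨fun s => ⟨Rat.cast_nonneg.2 (sparse_nonneg J s), ?_⟩, sparse_sum J⟩, ?_⟩
  · simpa using sparse_sum J {s}
  · exact ⟨fun _ s => sparse J s, (computable_sparse J hJ).comp Computable.snd,
      fun s => ⟨fun _ => ⟨sparse_nonneg J s, le_rfl⟩, tendsto_const_nhds⟩⟩

theorem cast_small (q : ℚ) (n : ℕ) : |(q : ℝ)| < (2 : ℝ)⁻¹ ^ n ↔ |q| < (2 : ℚ)⁻¹ ^ n := by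
  rw [← Rat.cast_lt (K := ℝ)]
  push_cast
  rfl

/-- No universal probability is computable. -/
theorem universal_prob_not_computable (m : Str → ℝ) (hm : UniversalProb m) :
    ¬ ∃ f : ℕ → Str → ℚ, Computable₂ f ∧
      ∀ (n : ℕ) (s : Str), |m s - (f n s : ℝ)| < (2 : ℝ)⁻¹ ^ n := by
  classical
  rintro ⟨f, hf, hfm⟩
  obtain ⟨⟨hsm, -⟩, huniv⟩ := hm
  let P : ℕ → ℕ → Prop := fun k j =>
    |f (2 * k + 1) (ones (Nat.pair k j))| < (2 : ℚ)⁻¹ ^ (2 * k)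
  have hPc : ComputablePred fun p : ℕ × ℕ => P p.1 p.2 := by
    have h2k : Computable (fun p : ℕ × ℕ => 2 * p.1) :=
      (Primrec.nat_mul.comp (Primrec.const 2) Primrec.fst).to_comp
    have h1 : Computable (fun p : ℕ × ℕ => ones (Nat.pair p.1 p.2)) :=
      (primrec_ones.comp (Primrec₂.natPair.comp Primrec.fst Primrec.snd)).to_comp
    have h2k' : Computable (fun p : ℕ × ℕ => 2 * p.1 + 1) := Computable.succ.comp h2k
    have hq : Computable (fun p : ℕ × ℕ => f (2 * p.1 + 1) (ones (Nat.pair p.1 p.2))) :=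
      Computable₂.comp hf h2k' h1
    have hg : Computable (fun p : ℕ × ℕ =>
        (f (2 * p.1 + 1) (ones (Nat.pair p.1 p.2)), 2 * p.1)) := Computable.pair hq h2k
    have := computablePred_comp computable_small hg
    exact this
  have hPex : ∀ k, ∃ j, P k j := by
    intro k
    obtain ⟨j, hj⟩ := exists_small m hsm k ((2 : ℝ)⁻¹ ^ (2 * k + 1)) (by positivity)
    refine ⟨j, ?_⟩
    have h1 := abs_lt.1 (hfm (2 * k + 1) (ones (Nat.pair k j)))
    have h0 := (hsm.1 (ones (Nat.pair k j))).1
    have h2 : |(f (2 * k + 1) (ones (Nat.pair k j)) : ℝ)| < (2 : ℝ)⁻¹ ^ (2 * k) := by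
      rw [pow_succ] at h1 hj
      rw [abs_lt]
      constructor <;> linarith
    show |_| < _
    exact (cast_small _ _).1 h2
  have hJ := Computable.find hPc hPex
  set J : ℕ → ℕ := fun k => Nat.find (hPex k)
  obtain ⟨c, hc, hdom⟩ := huniv _ (sparse_lc J hJ)
  obtain ⟨k, hk⟩ := exists_pow_lt_of_lt_one (show 0 < c / 4 by positivity)
    (show (2 : ℝ)⁻¹ < 1 by norm_num)
  have h1 := hdom (ones (Nat.pair k (J k)))
  simp only [sparse_ones] at h1
  have h2 : P k (J k) := Nat.find_spec (hPex k)
  have h3 : |(f (2 * k + 1) (ones (Nat.pair k (J k))) : ℝ)| < (2 : ℝ)⁻¹ ^ (2 * k) := by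
    exact (cast_small _ _).2 h2
  have h4 := (abs_lt.1 (hfm (2 * k + 1) (ones (Nat.pair k (J k))))).2
  have h5 := (abs_lt.1 h3).2
  have hx : 0 < (2 : ℝ)⁻¹ ^ k := by positivity
  push_cast at h1
  rw [pow_succ, two_mul, pow_add] at h4
  rw [two_mul, pow_add] at h5
  rw [pow_succ] at h1
  set x := (2 : ℝ)⁻¹ ^ k
  nlinarith

end Paper
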